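/- Quantum mutual information is nonincreasing under discarding a subsystem: for any state ρ on H_A ⊗ H_B ⊗ H_C, S(A : BC) ≥ S(A : B), where S(X:Y) = S(ρ_X) + S(ρ_Y) − S(ρ_XY). -/

import Mathlib

open Matrix BigOperators
open scoped Kronecker Classical ComplexOrder

noncomputable section

/-- Shannon entropy (base 2, with 0 log 0 = 0). -/
def shannon {ι : Type*} [Fintype ι] (p : ι → ℝ) : ℝ :=
  -∑ i, p i * Real.logb 2 (p i)

/-- Classical mutual information of a joint distribution. -/
def cMutualInfo {ι κ : Type*} [Fintype ι] [Fintype κ] (p : ι → κ → ℝ) : ℝ :=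
  shannon (fun i => ∑ s, p i s) + shannon (fun s => ∑ i, p i s)
    - shannon (fun x : ι × κ => p x.1 x.2)

/-- Von Neumann entropy (base 2) via eigenvalues of a Hermitian matrix. -/
def vnEntropy {n : Type*} [Fintype n] [DecidableEq n] (ρ : Matrix n n ℂ) : ℝ :=
  if h : ρ.IsHermitian then shannon h.eigenvalues else 0

/-- Partial trace over the second (right) factor. -/
def ptraceR {a b : Type*} [Fintype a] [Fintype b] (ρ : Matrix (a × b) (a × b) ℂ) :
    Matrix a a ℂ := fun i j => ∑ k, ρ (i, k) (j, k)

/-- Partial trace over the first (left) factor. -/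
def ptraceL {a b : Type*} [Fintype a] [Fintype b] (ρ : Matrix (a × b) (a × b) ℂ) :
    Matrix b b ℂ := fun i j => ∑ k, ρ (k, i) (k, j)

def IsDensityMatrix {n : Type*} [Fintype n] (ρ : Matrix n n ℂ) : Prop :=
  ρ.PosSemidef ∧ ρ.trace = 1

def IsPOVM {n ι : Type*} [Fintype n] [Fintype ι] [DecidableEq n]
    (M : ι → Matrix n n ℂ) : Prop :=
  (∀ i, (M i).PosSemidef) ∧ ∑ i, M i = 1

/-- Quantum mutual information S(A:B). -/
def qMutualInfo {a b : Type*} [Fintype a] [Fintype b] [DecidableEq a] [DecidableEq b]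
    (ρ : Matrix (a × b) (a × b) ℂ) : ℝ :=
  vnEntropy (ptraceR ρ) + vnEntropy (ptraceL ρ) - vnEntropy ρ

/-- Joint outcome probability of local measurements. -/
def measProb {a b ι κ : Type*} [Fintype a] [Fintype b] [Fintype ι] [Fintype κ]
    (ρ : Matrix (a × b) (a × b) ℂ) (M : ι → Matrix a a ℂ) (N : κ → Matrix b b ℂ)
    (i : ι) (s : κ) : ℝ := ((M i ⊗ₖ N s) * ρ).trace.re
/-- Partial trace over the third factor of a tripartite state, giving ρ_AB. -/
def ptrace3 {a b c : Type*} [Fintype a] [Fintype b] [Fintype c]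
    (ρ : Matrix (a × b × c) (a × b × c) ℂ) : Matrix (a × b) (a × b) ℂ :=
  fun i j => ∑ k, ρ (i.1, i.2, k) (j.1, j.2, k)

/-- The concave quadratic functional whose supremum over `X` is a quasi-entropy of `ρ` and `σ`. -/
def quasiFunctional {n : Type*} [Fintype n] (s t : ℝ) (ρ σ X : Matrix n n ℂ) : ℝ :=
  2 * (ρ * X).trace.re - s * (σ * (X * Xᴴ)).trace.re - t * (ρ * (Xᴴ * X)).trace.re

/-- The quasi-entropy in terms of the eigenvalues `p`, `q` and the overlap weights `w`. -/
def quasiEntropy {m n : Type*} [Fintype m] [Fintype n] (w : m → n → ℝ) (p : m → ℝ) (q : n → ℝ)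
    (s : ℝ) : ℝ :=
  ∑ i, ∑ j, w i j * p i ^ 2 / (s * q j + (1 - s) * p i)

/-- Interpolates between `∑ p log p` at `0` and the cross entropy term `∑ w p log q` at `1`. -/
def logInterp {m n : Type*} [Fintype m] [Fintype n] (w : m → n → ℝ) (p : m → ℝ) (q : n → ℝ)
    (s : ℝ) : ℝ :=
  ∑ i, ∑ j, w i j * p i * Real.log (s * q j + (1 - s) * p i)

/-- Transition probabilities between the orthonormal bases given by the columns of `U` and `V`. -/
def overlap {n : Type*} [Fintype n] (U V : Matrix n n ℂ) (i j : n) : ℝ :=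
  Complex.normSq ((Vᴴ * U) j i)

lemma overlap_nonneg {n : Type*} [Fintype n] (U V : Matrix n n ℂ) (i j : n) :
    0 ≤ overlap U V i j := Complex.normSq_nonneg _

lemma sum_overlap {n : Type*} [Fintype n] [DecidableEq n] {U V : Matrix n n ℂ}
    (hU : Uᴴ * U = 1) (hV : Vᴴ * V = 1) (i : n) : ∑ j, overlap U V i j = 1 := by
  have hV' : V * Vᴴ = 1 := mul_eq_one_comm.mp hV
  have h : (Vᴴ * U)ᴴ * (Vᴴ * U) = 1 := by
    rw [conjTranspose_mul, conjTranspose_conjTranspose, Matrix.mul_assoc, ← Matrix.mul_assoc V,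
      hV', Matrix.one_mul, hU]
  have h2 := congrArg Complex.re (congrFun (congrFun h i) i)
  rw [Matrix.mul_apply] at h2
  simpa [overlap, Complex.normSq_apply] using h2

lemma hasDerivAt_logInterp {m n : Type*} [Fintype m] [Fintype n] {w : m → n → ℝ} {p : m → ℝ}
    {q : n → ℝ} (hp : ∀ i, 0 ≤ p i) (hq : ∀ j, 0 ≤ q j) {s : ℝ} (hs : s ∈ Set.Ioo (0 : ℝ) 1) :
    HasDerivAt (logInterp w p q) (((∑ i, ∑ j, w i j * p i) - quasiEntropy w p q s) / s) s := by
  have key : ∀ i j, HasDerivAt (fun s => w i j * p i * Real.log (s * q j + (1 - s) * p i))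
      ((w i j * p i - w i j * p i ^ 2 / (s * q j + (1 - s) * p i)) / s) s := by
    intro i j
    rcases (hp i).eq_or_lt with h | h
    · simpa [← h] using hasDerivAt_const s (0 : ℝ)
    · have h1 : 0 < (1 - s) * p i := mul_pos (sub_pos.mpr hs.2) h
      have h2 : 0 < s * q j + (1 - s) * p i :=
        add_pos_of_nonneg_of_pos (mul_nonneg hs.1.le (hq j)) h1
      have h3 : HasDerivAt (fun s : ℝ => s * q j + (1 - s) * p i) (1 * q j + (-1) * p i) s :=
        ((hasDerivAt_id s).mul_const _).add (((hasDerivAt_id s).const_sub 1).mul_const _)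
      refine ((h3.log h2.ne').const_mul (w i j * p i)).congr_deriv ?_
      have hD : s * (1 * q j + -1 * p i) = s * q j + (1 - s) * p i - p i := by ring
      rw [eq_div_iff hs.1.ne', mul_assoc, div_mul_eq_mul_div, mul_comm _ s, hD, sub_div,
        div_self h2.ne']
      ring
  have := HasDerivAt.fun_sum (u := Finset.univ) fun i _ =>
    HasDerivAt.fun_sum (u := Finset.univ) fun j _ => key i j
  refine this.congr_deriv ?_
  simp only [quasiEntropy, sub_div, Finset.sum_sub_distrib, Finset.sum_div]

lemma continuousOn_logInterp {m n : Type*} [Fintype m] [Fintype n] {w : m → n → ℝ} {p : m → ℝ}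
    {q : n → ℝ} (hp : ∀ i, 0 ≤ p i) (hq : ∀ j, 0 ≤ q j)
    (hsupp : ∀ i j, q j = 0 → w i j * p i = 0) :
    ContinuousOn (logInterp w p q) (Set.Icc 0 1) := by
  refine continuousOn_finsetSum _ fun i _ => continuousOn_finsetSum _ fun j _ => ?_
  rcases (hp i).eq_or_lt with h | h
  · simpa [← h] using continuousOn_const
  rcases (hq j).eq_or_lt with h' | h'
  · simpa [hsupp i j h'.symm] using continuousOn_const
  refine continuousOn_const.mul (ContinuousOn.log (by fun_prop) fun s hs => ?_)
  rcases hs.1.eq_or_lt with h0 | h0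
  · simpa [← h0] using h.ne'
  · have h1 : 0 ≤ (1 - s) * p i := mul_nonneg (sub_nonneg.mpr hs.2) h.le
    have h2 := mul_pos h0 h'
    positivity

/-- Comparing the quasi-entropies for all parameters compares the relative entropies. -/
lemma logInterp_sub_le {m n m' n' : Type*} [Fintype m] [Fintype n] [Fintype m'] [Fintype n']
    {w : m → n → ℝ} {p : m → ℝ} {q : n → ℝ} {w' : m' → n' → ℝ} {p' : m' → ℝ} {q' : n' → ℝ}
    (hp : ∀ i, 0 ≤ p i) (hq : ∀ j, 0 ≤ q j) (hp' : ∀ i, 0 ≤ p' i) (hq' : ∀ j, 0 ≤ q' j)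
    (hsupp : ∀ i j, q j = 0 → w i j * p i = 0) (hsupp' : ∀ i j, q' j = 0 → w' i j * p' i = 0)
    (hsum : ∑ i, ∑ j, w i j * p i = ∑ i, ∑ j, w' i j * p' i)
    (hle : ∀ s ∈ Set.Ioo (0 : ℝ) 1, quasiEntropy w p q s ≤ quasiEntropy w' p' q' s) :
    logInterp w p q 0 - logInterp w p q 1 ≤ logInterp w' p' q' 0 - logInterp w' p' q' 1 := by
  have hd : ∀ s ∈ Set.Ioo (0 : ℝ) 1, HasDerivAt (fun s => logInterp w p q s - logInterp w' p' q' s)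
      _ s := fun s hs => (hasDerivAt_logInterp hp hq hs).sub (hasDerivAt_logInterp hp' hq' hs)
  have hmono : MonotoneOn (fun s => logInterp w p q s - logInterp w' p' q' s) (Set.Icc 0 1) := by
    refine monotoneOn_of_deriv_nonneg (convex_Icc 0 1)
      ((continuousOn_logInterp hp hq hsupp).sub (continuousOn_logInterp hp' hq' hsupp')) ?_ ?_
    · rw [interior_Icc]
      exact fun s hs => (hd s hs).differentiableAt.differentiableWithinAt
    · rw [interior_Icc]
      intro s hs
      rw [(hd s hs).deriv, ← sub_div]
      refine div_nonneg ?_ hs.1.le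
      linarith [hle s hs]
  have := hmono (Set.left_mem_Icc.mpr zero_le_one) (Set.right_mem_Icc.mpr zero_le_one) zero_le_one
  dsimp only at this
  linarith

lemma trace_diagonal_mul_mul_conjTranspose {n : Type*} [Fintype n] [DecidableEq n] (q : n → ℝ)
    (Y : Matrix n n ℂ) :
    (diagonal (fun i => (q i : ℂ)) * (Y * Yᴴ)).trace.re =
      ∑ i, ∑ j, q j * Complex.normSq (Y j i) := by
  rw [Finset.sum_comm]
  simp only [Matrix.trace, Matrix.diag, Matrix.diagonal_mul, Complex.re_sum,
    Complex.re_ofReal_mul, Matrix.mul_apply (M := Y), Matrix.conjTranspose_apply,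
    RCLike.star_def, Complex.mul_conj, Complex.ofReal_re, Finset.mul_sum]

lemma trace_diagonal_mul_conjTranspose_mul {n : Type*} [Fintype n] [DecidableEq n] (p : n → ℝ)
    (Y : Matrix n n ℂ) :
    (diagonal (fun i => (p i : ℂ)) * (Yᴴ * Y)).trace.re =
      ∑ i, ∑ j, p i * Complex.normSq (Y j i) := by
  simp only [Matrix.trace, Matrix.diag, Matrix.diagonal_mul, Complex.re_sum,
    Complex.re_ofReal_mul, Matrix.mul_apply (M := Yᴴ), Matrix.conjTranspose_apply,
    RCLike.star_def, ← Complex.normSq_eq_conj_mul_self, Complex.ofReal_re, Finset.mul_sum]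

lemma quasiFunctional_eq_sum {n : Type*} [Fintype n] [DecidableEq n] {U V : Matrix n n ℂ}
    (hU : Uᴴ * U = 1) (hV : Vᴴ * V = 1) (p q : n → ℝ) (s t : ℝ) (Y : Matrix n n ℂ) :
    quasiFunctional s t (U * diagonal (fun i => (p i : ℂ)) * Uᴴ)
      (V * diagonal (fun i => (q i : ℂ)) * Vᴴ) (V * Y * Uᴴ) =
      ∑ i, ∑ j, (2 * p i * (star ((Vᴴ * U) j i) * Y j i).re
        - (s * q j + t * p i) * Complex.normSq (Y j i)) := by
  have h1 : ((U * diagonal (fun i => (p i : ℂ)) * Uᴴ) * (V * Y * Uᴴ)).trace.re =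
      ∑ i, ∑ j, p i * (star ((Vᴴ * U) j i) * Y j i).re := by
    have : ((U * diagonal (fun i => (p i : ℂ)) * Uᴴ) * (V * Y * Uᴴ)).trace =
        (diagonal (fun i => (p i : ℂ)) * ((Vᴴ * U)ᴴ * Y)).trace := by
      rw [conjTranspose_mul, conjTranspose_conjTranspose, ← Matrix.mul_assoc, Matrix.trace_mul_comm]
      simp only [← Matrix.mul_assoc, hU, Matrix.one_mul]
    rw [this]
    simp only [Matrix.trace, Matrix.diag, Matrix.diagonal_mul, Complex.re_sum,
      Complex.re_ofReal_mul, Matrix.mul_apply (M := (Vᴴ * U)ᴴ), Matrix.conjTranspose_apply,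
      Finset.mul_sum]
  have h2 : ((V * diagonal (fun i => (q i : ℂ)) * Vᴴ) * ((V * Y * Uᴴ) * (V * Y * Uᴴ)ᴴ)).trace =
      (diagonal (fun i => (q i : ℂ)) * (Y * Yᴴ)).trace := by
    have : (V * diagonal (fun i => (q i : ℂ)) * Vᴴ) * ((V * Y * Uᴴ) * (V * Y * Uᴴ)ᴴ) =
        V * (diagonal (fun i => (q i : ℂ)) * (Vᴴ * V) * Y * (Uᴴ * U) * Yᴴ * Vᴴ) := by
      simp only [conjTranspose_mul, conjTranspose_conjTranspose, Matrix.mul_assoc]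
    rw [this, Matrix.trace_mul_comm, hU, hV, Matrix.mul_assoc _ Vᴴ V, hV]
    simp only [Matrix.mul_one, Matrix.mul_assoc]
  have h3 : ((U * diagonal (fun i => (p i : ℂ)) * Uᴴ) * ((V * Y * Uᴴ)ᴴ * (V * Y * Uᴴ))).trace =
      (diagonal (fun i => (p i : ℂ)) * (Yᴴ * Y)).trace := by
    have : (U * diagonal (fun i => (p i : ℂ)) * Uᴴ) * ((V * Y * Uᴴ)ᴴ * (V * Y * Uᴴ)) =
        U * (diagonal (fun i => (p i : ℂ)) * (Uᴴ * U) * Yᴴ * (Vᴴ * V) * Y * Uᴴ) := by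
      simp only [conjTranspose_mul, conjTranspose_conjTranspose, Matrix.mul_assoc]
    rw [this, Matrix.trace_mul_comm, hU, hV, Matrix.mul_assoc _ Uᴴ U, hU]
    simp only [Matrix.mul_one, Matrix.mul_assoc]
  rw [quasiFunctional, h1, h2, h3, trace_diagonal_mul_mul_conjTranspose,
    trace_diagonal_mul_conjTranspose_mul]
  simp only [Finset.mul_sum, ← Finset.sum_sub_distrib]
  refine Finset.sum_congr rfl fun i _ => Finset.sum_congr rfl fun j _ => ?_
  ring

lemma quasiFunctional_le {n : Type*} [Fintype n] [DecidableEq n] {U V : Matrix n n ℂ}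
    (hU : Uᴴ * U = 1) (hV : Vᴴ * V = 1) {p q : n → ℝ} (hp : ∀ i, 0 ≤ p i) (hq : ∀ i, 0 ≤ q i)
    {s : ℝ} (hs : s ∈ Set.Ioo (0 : ℝ) 1) (X : Matrix n n ℂ) :
    quasiFunctional s (1 - s) (U * diagonal (fun i => (p i : ℂ)) * Uᴴ)
      (V * diagonal (fun i => (q i : ℂ)) * Vᴴ) X ≤ quasiEntropy (overlap U V) p q s := by
  obtain ⟨Y, rfl⟩ : ∃ Y, X = V * Y * Uᴴ := by
    refine ⟨Vᴴ * X * U, ?_⟩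
    have : V * (Vᴴ * X * U) * Uᴴ = (V * Vᴴ) * X * (U * Uᴴ) := by simp only [Matrix.mul_assoc]
    rw [this, mul_eq_one_comm.mp hU, mul_eq_one_comm.mp hV, Matrix.one_mul, Matrix.mul_one]
  rw [quasiFunctional_eq_sum hU hV]
  refine Finset.sum_le_sum fun i _ => Finset.sum_le_sum fun j _ => ?_
  have h0 : 0 ≤ s * q j := mul_nonneg hs.1.le (hq j)
  rcases (hp i).eq_or_lt with h | h
  · simpa [← h] using mul_nonneg h0 (Complex.normSq_nonneg _)
  have h1 : 0 < (1 - s) * p i := mul_pos (sub_pos.mpr hs.2) h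
  have h2 : 0 < s * q j + (1 - s) * p i := by positivity
  set D := s * q j + (1 - s) * p i
  rw [le_div_iff₀ h2, overlap]
  have : 0 ≤ (p i * ((Vᴴ * U) j i).re - D * (Y j i).re) ^ 2
      + (p i * ((Vᴴ * U) j i).im - D * (Y j i).im) ^ 2 := by positivity
  simp only [Complex.normSq_apply, Complex.mul_re, RCLike.star_def, Complex.conj_re,
    Complex.conj_im]
  linarith

lemma exists_quasiFunctional_eq {n : Type*} [Fintype n] [DecidableEq n] {U V : Matrix n n ℂ}
    (hU : Uᴴ * U = 1) (hV : Vᴴ * V = 1) {p q : n → ℝ} (hp : ∀ i, 0 ≤ p i) (hq : ∀ i, 0 ≤ q i)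
    {s : ℝ} (hs : s ∈ Set.Ioo (0 : ℝ) 1) :
    ∃ X, quasiFunctional s (1 - s) (U * diagonal (fun i => (p i : ℂ)) * Uᴴ)
      (V * diagonal (fun i => (q i : ℂ)) * Vᴴ) X = quasiEntropy (overlap U V) p q s := by
  refine ⟨V * Matrix.of (fun j i => ((p i / (s * q j + (1 - s) * p i) : ℝ) : ℂ) *
    (Vᴴ * U) j i) * Uᴴ, ?_⟩
  rw [quasiFunctional_eq_sum hU hV]
  refine Finset.sum_congr rfl fun i _ => Finset.sum_congr rfl fun j _ => ?_
  have h0 : 0 ≤ s * q j := mul_nonneg hs.1.le (hq j)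
  rcases (hp i).eq_or_lt with h | h
  · simp [← h]
  have h1 : 0 < (1 - s) * p i := mul_pos (sub_pos.mpr hs.2) h
  have h2 : s * q j + (1 - s) * p i ≠ 0 := by positivity
  rw [Matrix.of_apply]
  generalize s * q j + (1 - s) * p i = D at *
  rw [overlap, mul_left_comm, Complex.re_ofReal_mul, Complex.normSq_mul,
    Complex.normSq_ofReal, RCLike.star_def, mul_comm (starRingEnd ℂ _), Complex.mul_conj,
    Complex.ofReal_re]
  field_simp
  ring

lemma quasiFunctional_map {m n : Type*} [Fintype m] [DecidableEq m] [Fintype n] [DecidableEq n]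
    (φ : Matrix m m ℂ →⋆ₐ[ℂ] Matrix n n ℂ) {ρ₁ σ₁ : Matrix m m ℂ} {ρ σ : Matrix n n ℂ}
    (hρ : ∀ X, (ρ₁ * X).trace = (ρ * φ X).trace) (hσ : ∀ X, (σ₁ * X).trace = (σ * φ X).trace)
    (s t : ℝ) (X : Matrix m m ℂ) :
    quasiFunctional s t ρ₁ σ₁ X = quasiFunctional s t ρ σ (φ X) := by
  have h : φ Xᴴ = (φ X)ᴴ := map_star φ X
  simp only [quasiFunctional, hρ, hσ, map_mul, h]

lemma sum_overlap_mul {n : Type*} [Fintype n] [DecidableEq n] {U V : Matrix n n ℂ}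
    (hU : Uᴴ * U = 1) (hV : Vᴴ * V = 1) (f : n → ℝ) :
    ∑ i, ∑ j, overlap U V i j * f i = ∑ i, f i := by
  simp only [← Finset.sum_mul, sum_overlap hU hV, one_mul]

lemma trace_conj_diagonal {n : Type*} [Fintype n] [DecidableEq n] {U : Matrix n n ℂ}
    (hU : Uᴴ * U = 1) (p : n → ℝ) :
    (U * diagonal (fun i => (p i : ℂ)) * Uᴴ).trace.re = ∑ i, p i := by
  rw [Matrix.mul_assoc, Matrix.trace_mul_comm, Matrix.mul_assoc, hU, Matrix.mul_one,
    Matrix.trace_diagonal]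
  simp

/-- Relative entropy does not increase under the trace dual of a unital ⋆-homomorphism. -/
lemma relEntropy_mono {m n : Type*} [Fintype m] [DecidableEq m] [Fintype n] [DecidableEq n]
    (φ : Matrix m m ℂ →⋆ₐ[ℂ] Matrix n n ℂ) {ρ₁ σ₁ : Matrix m m ℂ} {ρ σ : Matrix n n ℂ}
    (hρ : ∀ X, (ρ₁ * X).trace = (ρ * φ X).trace) (hσ : ∀ X, (σ₁ * X).trace = (σ * φ X).trace)
    {U₁ V₁ : Matrix m m ℂ} {U V : Matrix n n ℂ} {p₁ q₁ : m → ℝ} {p q : n → ℝ}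
    (hU₁ : U₁ᴴ * U₁ = 1) (hV₁ : V₁ᴴ * V₁ = 1) (hU : Uᴴ * U = 1) (hV : Vᴴ * V = 1)
    (hp₁ : ∀ i, 0 ≤ p₁ i) (hq₁ : ∀ i, 0 ≤ q₁ i) (hp : ∀ i, 0 ≤ p i) (hq : ∀ i, 0 ≤ q i)
    (eρ₁ : ρ₁ = U₁ * diagonal (fun i => (p₁ i : ℂ)) * U₁ᴴ)
    (eσ₁ : σ₁ = V₁ * diagonal (fun i => (q₁ i : ℂ)) * V₁ᴴ)
    (eρ : ρ = U * diagonal (fun i => (p i : ℂ)) * Uᴴ)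
    (eσ : σ = V * diagonal (fun i => (q i : ℂ)) * Vᴴ)
    (hsupp₁ : ∀ i j, q₁ j = 0 → overlap U₁ V₁ i j * p₁ i = 0)
    (hsupp : ∀ i j, q j = 0 → overlap U V i j * p i = 0) :
    logInterp (overlap U₁ V₁) p₁ q₁ 0 - logInterp (overlap U₁ V₁) p₁ q₁ 1 ≤
      logInterp (overlap U V) p q 0 - logInterp (overlap U V) p q 1 := by
  refine logInterp_sub_le hp₁ hq₁ hp hq hsupp₁ hsupp ?_ fun s hs => ?_
  · rw [sum_overlap_mul hU₁ hV₁, sum_overlap_mul hU hV, ← trace_conj_diagonal hU₁,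
      ← trace_conj_diagonal hU, ← eρ₁, ← eρ]
    have := hρ 1
    rw [map_one, Matrix.mul_one, Matrix.mul_one] at this
    rw [this]
  · obtain ⟨X, hX⟩ := exists_quasiFunctional_eq hU₁ hV₁ hp₁ hq₁ hs
    rw [← hX, ← eρ₁, ← eσ₁, quasiFunctional_map φ hρ hσ, eρ, eσ]
    exact quasiFunctional_le hU hV hp hq hs _

lemma Matrix.IsHermitian.eq_conj_diagonal {n : Type*} [Fintype n] [DecidableEq n] {A : Matrix n n ℂ}
    (hA : A.IsHermitian) :
    A = (hA.eigenvectorUnitary : Matrix n n ℂ) * diagonal (fun i => (hA.eigenvalues i : ℂ)) *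
      (hA.eigenvectorUnitary : Matrix n n ℂ)ᴴ := by
  conv_lhs => rw [hA.spectral_theorem, Unitary.conjStarAlgAut_apply]
  rfl

lemma Matrix.IsHermitian.eigenvectorUnitary_conjTranspose_mul {n : Type*} [Fintype n] [DecidableEq n]
    {A : Matrix n n ℂ} (hA : A.IsHermitian) :
    (hA.eigenvectorUnitary : Matrix n n ℂ)ᴴ * hA.eigenvectorUnitary = 1 :=
  Unitary.coe_star_mul_self _

lemma trace_ptraceR_mul {a b : Type*} [Fintype a] [Fintype b] [DecidableEq b]
    (τ : Matrix (a × b) (a × b) ℂ) (X : Matrix a a ℂ) :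
    (ptraceR τ * X).trace = (τ * (X ⊗ₖ (1 : Matrix b b ℂ))).trace := by
  simp only [Matrix.trace, Matrix.diag, Matrix.mul_apply, ptraceR, Fintype.sum_prod_type,
    Matrix.kroneckerMap_apply, Matrix.one_apply, mul_ite, mul_one, mul_zero, Finset.sum_mul,
    Finset.sum_ite_eq', Finset.mem_univ, if_true]
  exact Finset.sum_congr rfl fun i _ => Finset.sum_comm

lemma trace_ptraceL_mul {a b : Type*} [Fintype a] [Fintype b] [DecidableEq a]
    (τ : Matrix (a × b) (a × b) ℂ) (X : Matrix b b ℂ) :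
    (ptraceL τ * X).trace = (τ * ((1 : Matrix a a ℂ) ⊗ₖ X)).trace := by
  simp only [Matrix.trace, Matrix.diag, Matrix.mul_apply, ptraceL, Fintype.sum_prod_type_right,
    Matrix.kroneckerMap_apply, Matrix.one_apply, ite_mul, mul_ite, one_mul, zero_mul, mul_zero,
    Finset.sum_mul, Finset.sum_ite_eq', Finset.mem_univ, if_true]
  exact Finset.sum_congr rfl fun i _ => Finset.sum_comm

lemma ptraceR_conj_kronecker {a b : Type*} [Fintype a] [Fintype b] [DecidableEq a] [DecidableEq b]
    (τ : Matrix (a × b) (a × b) ℂ) (A : Matrix a a ℂ) {B : Matrix b b ℂ} (hB : Bᴴ * B = 1) :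
    ptraceR ((A ⊗ₖ B)ᴴ * τ * (A ⊗ₖ B)) = Aᴴ * ptraceR τ * A := by
  refine Matrix.ext_iff_trace_mul_right.mpr fun X => ?_
  have h : (A ⊗ₖ B) * (X ⊗ₖ (1 : Matrix b b ℂ)) * (A ⊗ₖ B)ᴴ = (A * X * Aᴴ) ⊗ₖ 1 := by
    rw [conjTranspose_kronecker, ← mul_kronecker_mul, ← mul_kronecker_mul, Matrix.mul_one,
      mul_eq_one_comm.mp hB]
  rw [trace_ptraceR_mul, Matrix.mul_assoc, Matrix.mul_assoc, Matrix.trace_mul_comm,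
    Matrix.mul_assoc, h, ← trace_ptraceR_mul, Matrix.mul_assoc Aᴴ, Matrix.mul_assoc Aᴴ,
    Matrix.trace_mul_comm Aᴴ]
  simp only [Matrix.mul_assoc]

lemma ptraceL_conj_kronecker {a b : Type*} [Fintype a] [Fintype b] [DecidableEq a] [DecidableEq b]
    (τ : Matrix (a × b) (a × b) ℂ) {A : Matrix a a ℂ} (hA : Aᴴ * A = 1) (B : Matrix b b ℂ) :
    ptraceL ((A ⊗ₖ B)ᴴ * τ * (A ⊗ₖ B)) = Bᴴ * ptraceL τ * B := by
  refine Matrix.ext_iff_trace_mul_right.mpr fun X => ?_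
  have h : (A ⊗ₖ B) * ((1 : Matrix a a ℂ) ⊗ₖ X) * (A ⊗ₖ B)ᴴ = 1 ⊗ₖ (B * X * Bᴴ) := by
    rw [conjTranspose_kronecker, ← mul_kronecker_mul, ← mul_kronecker_mul, Matrix.mul_one,
      mul_eq_one_comm.mp hA]
  rw [trace_ptraceL_mul, Matrix.mul_assoc, Matrix.mul_assoc, Matrix.trace_mul_comm,
    Matrix.mul_assoc, h, ← trace_ptraceL_mul, Matrix.mul_assoc Bᴴ, Matrix.mul_assoc Bᴴ,
    Matrix.trace_mul_comm Bᴴ]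
  simp only [Matrix.mul_assoc]

lemma sum_overlap_mul_eq_diag {n : Type*} [Fintype n] [DecidableEq n] (U V : Matrix n n ℂ)
    (p : n → ℝ) (j : n) :
    ∑ i, overlap U V i j * p i =
      ((Vᴴ * (U * diagonal (fun i => (p i : ℂ)) * Uᴴ) * V) j j).re := by
  have h : Vᴴ * (U * diagonal (fun i => (p i : ℂ)) * Uᴴ) * V =
      (Vᴴ * U * diagonal (fun i => (p i : ℂ))) * (Vᴴ * U)ᴴ := by
    simp only [conjTranspose_mul, conjTranspose_conjTranspose, Matrix.mul_assoc]
  rw [h, Matrix.mul_apply]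
  simp only [Matrix.mul_diagonal, Matrix.conjTranspose_apply, RCLike.star_def,
    mul_right_comm _ (Complex.ofReal _), Complex.mul_conj, ← Complex.ofReal_mul, Complex.re_sum,
    Complex.ofReal_re, overlap]

lemma Matrix.IsHermitian.conj_eigenvectorUnitary {n : Type*} [Fintype n] [DecidableEq n]
    {A : Matrix n n ℂ} (hA : A.IsHermitian) :
    (hA.eigenvectorUnitary : Matrix n n ℂ)ᴴ * A * hA.eigenvectorUnitary =
      diagonal (fun i => (hA.eigenvalues i : ℂ)) := by
  have h := hA.eigenvectorUnitary_conjTranspose_mul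
  have e := hA.eq_conj_diagonal
  generalize (hA.eigenvectorUnitary : Matrix n n ℂ) = U at h e ⊢
  have : Uᴴ * A * U = (Uᴴ * U) * diagonal (fun i => (hA.eigenvalues i : ℂ)) * (Uᴴ * U) := by
    generalize hA.eigenvalues = p at e ⊢
    simp only [e, Matrix.mul_assoc]
  rw [this, h, Matrix.one_mul, Matrix.mul_one]

lemma Matrix.PosSemidef.ptraceR {a b : Type*} [Fintype a] [Fintype b] {τ : Matrix (a × b) (a × b) ℂ}
    (h : τ.PosSemidef) : (ptraceR τ).PosSemidef := by
  have e : _root_.ptraceR τ = ∑ k, τ.submatrix (fun i => (i, k)) (fun i => (i, k)) := by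
    ext i j
    simp [_root_.ptraceR, Matrix.sum_apply]
  rw [e]
  exact posSemidef_sum _ fun k _ => h.submatrix _

lemma Matrix.PosSemidef.ptraceL {a b : Type*} [Fintype a] [Fintype b] {τ : Matrix (a × b) (a × b) ℂ}
    (h : τ.PosSemidef) : (ptraceL τ).PosSemidef := by
  have e : _root_.ptraceL τ = ∑ k, τ.submatrix (fun i => (k, i)) (fun i => (k, i)) := by
    ext i j
    simp [_root_.ptraceL, Matrix.sum_apply]
  rw [e]
  exact posSemidef_sum _ fun k _ => h.submatrix _

lemma Matrix.PosSemidef.ptrace3 {a b c : Type*} [Fintype a] [Fintype b] [Fintype c]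
    {ρ : Matrix (a × b × c) (a × b × c) ℂ} (h : ρ.PosSemidef) : (ptrace3 ρ).PosSemidef :=
  PosSemidef.ptraceR (h.submatrix (Equiv.prodAssoc a b c))

lemma vnEntropy_eq {n : Type*} [Fintype n] [DecidableEq n] {A : Matrix n n ℂ}
    (hA : A.IsHermitian) :
    vnEntropy A = -(∑ i, hA.eigenvalues i * Real.log (hA.eigenvalues i)) / Real.log 2 := by
  simp only [vnEntropy, dif_pos hA, shannon, Real.logb, neg_div, Finset.sum_div, mul_div_assoc]

section ProductBasis

variable {a b : Type*} [Fintype a] [Fintype b] [DecidableEq a] [DecidableEq b]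
  {τ : Matrix (a × b) (a × b) ℂ} (hτ : τ.PosSemidef)

/-- Product of the eigenbases of the two marginals. -/
def marginalBasis : Matrix (a × b) (a × b) ℂ :=
  (hτ.ptraceR.isHermitian.eigenvectorUnitary : Matrix a a ℂ) ⊗ₖ
    (hτ.ptraceL.isHermitian.eigenvectorUnitary : Matrix b b ℂ)

/-- Eigenvalues of the product of the two marginals. -/
def marginalEigenvalues (x : a × b) : ℝ :=
  hτ.ptraceR.isHermitian.eigenvalues x.1 * hτ.ptraceL.isHermitian.eigenvalues x.2

/-- Overlaps between an eigenbasis of `τ` and the product eigenbasis of its marginals. -/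
def marginalOverlap (i j : a × b) : ℝ :=
  overlap (hτ.isHermitian.eigenvectorUnitary : Matrix (a × b) (a × b) ℂ) (marginalBasis hτ) i j

lemma marginalBasis_conjTranspose_mul : (marginalBasis hτ)ᴴ * marginalBasis hτ = 1 := by
  rw [marginalBasis, conjTranspose_kronecker, ← mul_kronecker_mul,
    IsHermitian.eigenvectorUnitary_conjTranspose_mul,
    IsHermitian.eigenvectorUnitary_conjTranspose_mul, one_kronecker_one]

lemma kronecker_marginals_eq : ptraceR τ ⊗ₖ ptraceL τ =
    marginalBasis hτ * diagonal (fun x => (marginalEigenvalues hτ x : ℂ)) *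
      (marginalBasis hτ)ᴴ := by
  have h : diagonal (fun x => (marginalEigenvalues hτ x : ℂ)) =
      diagonal (fun i => (hτ.ptraceR.isHermitian.eigenvalues i : ℂ)) ⊗ₖ
        diagonal (fun i => (hτ.ptraceL.isHermitian.eigenvalues i : ℂ)) := by
    rw [diagonal_kronecker_diagonal]
    simp [marginalEigenvalues]
  rw [h, marginalBasis, conjTranspose_kronecker, ← mul_kronecker_mul, ← mul_kronecker_mul,
    ← hτ.ptraceR.isHermitian.eq_conj_diagonal, ← hτ.ptraceL.isHermitian.eq_conj_diagonal]

lemma marginalEigenvalues_nonneg (x : a × b) : 0 ≤ marginalEigenvalues hτ x :=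
  mul_nonneg (hτ.ptraceR.eigenvalues_nonneg _) (hτ.ptraceL.eigenvalues_nonneg _)

/-- Joint distribution of measuring `τ` in the product eigenbasis of its marginals. -/
def marginalProb (j : a × b) : ℝ :=
  ∑ i, marginalOverlap hτ i j * hτ.isHermitian.eigenvalues i

lemma marginalProb_eq (j : a × b) :
    marginalProb hτ j = (((marginalBasis hτ)ᴴ * τ * marginalBasis hτ) j j).re := by
  rw [marginalProb]
  simp only [marginalOverlap]
  rw [sum_overlap_mul_eq_diag, ← hτ.isHermitian.eq_conj_diagonal]

lemma sum_marginalProb_right (k : a) :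
    ∑ l, marginalProb hτ (k, l) = hτ.ptraceR.isHermitian.eigenvalues k := by
  have h := ptraceR_conj_kronecker τ (hτ.ptraceR.isHermitian.eigenvectorUnitary : Matrix a a ℂ)
    hτ.ptraceL.isHermitian.eigenvectorUnitary_conjTranspose_mul
  rw [IsHermitian.conj_eigenvectorUnitary] at h
  have h2 := congrArg Complex.re (congrFun (congrFun h k) k)
  rw [diagonal_apply_eq, Complex.ofReal_re] at h2
  rw [← h2, ptraceR, Complex.re_sum]
  exact Finset.sum_congr rfl fun _ _ => marginalProb_eq hτ _

lemma sum_marginalProb_left (l : b) :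
    ∑ k, marginalProb hτ (k, l) = hτ.ptraceL.isHermitian.eigenvalues l := by
  have h := ptraceL_conj_kronecker τ hτ.ptraceR.isHermitian.eigenvectorUnitary_conjTranspose_mul
    (hτ.ptraceL.isHermitian.eigenvectorUnitary : Matrix b b ℂ)
  rw [IsHermitian.conj_eigenvectorUnitary] at h
  have h2 := congrArg Complex.re (congrFun (congrFun h l) l)
  rw [diagonal_apply_eq, Complex.ofReal_re] at h2
  rw [← h2, ptraceL, Complex.re_sum]
  exact Finset.sum_congr rfl fun _ _ => marginalProb_eq hτ _

lemma marginalOverlap_mul_nonneg (i j : a × b) :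
    0 ≤ marginalOverlap hτ i j * hτ.isHermitian.eigenvalues i :=
  mul_nonneg (overlap_nonneg _ _ _ _) (hτ.eigenvalues_nonneg i)

lemma marginalProb_nonneg (j : a × b) : 0 ≤ marginalProb hτ j :=
  Finset.sum_nonneg fun i _ => marginalOverlap_mul_nonneg hτ i j

lemma marginalProb_eq_zero {j : a × b} (h : marginalEigenvalues hτ j = 0) :
    marginalProb hτ j = 0 := by
  obtain ⟨k, l⟩ := j
  rcases mul_eq_zero.mp h with h | h
  · rw [← sum_marginalProb_right hτ,
      Finset.sum_eq_zero_iff_of_nonneg fun _ _ => marginalProb_nonneg hτ _] at h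
    exact h l (Finset.mem_univ _)
  · rw [← sum_marginalProb_left hτ,
      Finset.sum_eq_zero_iff_of_nonneg fun _ _ => marginalProb_nonneg hτ _] at h
    exact h k (Finset.mem_univ _)

lemma marginalOverlap_mul_eq_zero (i j : a × b) (h : marginalEigenvalues hτ j = 0) :
    marginalOverlap hτ i j * hτ.isHermitian.eigenvalues i = 0 :=
  (Finset.sum_eq_zero_iff_of_nonneg fun i _ => marginalOverlap_mul_nonneg hτ i j).mp
    (marginalProb_eq_zero hτ h) i (Finset.mem_univ _)

lemma logInterp_marginal_zero :
    logInterp (marginalOverlap hτ) hτ.isHermitian.eigenvalues (marginalEigenvalues hτ) 0 =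
      ∑ i, hτ.isHermitian.eigenvalues i * Real.log (hτ.isHermitian.eigenvalues i) := by
  rw [← sum_overlap_mul hτ.isHermitian.eigenvectorUnitary_conjTranspose_mul
    (marginalBasis_conjTranspose_mul hτ)]
  simp [logInterp, marginalOverlap, mul_assoc]

lemma logInterp_marginal_one :
    logInterp (marginalOverlap hτ) hτ.isHermitian.eigenvalues (marginalEigenvalues hτ) 1 =
      (∑ i, hτ.ptraceR.isHermitian.eigenvalues i *
        Real.log (hτ.ptraceR.isHermitian.eigenvalues i)) +
      ∑ i, hτ.ptraceL.isHermitian.eigenvalues i *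
        Real.log (hτ.ptraceL.isHermitian.eigenvalues i) := by
  have h : logInterp (marginalOverlap hτ) hτ.isHermitian.eigenvalues (marginalEigenvalues hτ) 1 =
      ∑ j, marginalProb hτ j * Real.log (marginalEigenvalues hτ j) := by
    rw [logInterp, Finset.sum_comm]
    simp [marginalProb, Finset.sum_mul]
  have h2 : ∀ j, marginalProb hτ j * Real.log (marginalEigenvalues hτ j) =
      marginalProb hτ j * Real.log (hτ.ptraceR.isHermitian.eigenvalues j.1) +
      marginalProb hτ j * Real.log (hτ.ptraceL.isHermitian.eigenvalues j.2) := by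
    intro j
    by_cases hj : marginalEigenvalues hτ j = 0
    · simp [marginalProb_eq_zero hτ hj]
    · rw [← mul_add, marginalEigenvalues,
        Real.log_mul (left_ne_zero_of_mul hj) (right_ne_zero_of_mul hj)]
  rw [h, Finset.sum_congr rfl fun j _ => h2 j, Finset.sum_add_distrib, Fintype.sum_prod_type,
    Fintype.sum_prod_type_right]
  simp only [← Finset.sum_mul, sum_marginalProb_right, sum_marginalProb_left]

/-- Mutual information is the relative entropy to the product of the marginals. -/
lemma qMutualInfo_eq : qMutualInfo τ =
    (logInterp (marginalOverlap hτ) hτ.isHermitian.eigenvalues (marginalEigenvalues hτ) 0 -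
      logInterp (marginalOverlap hτ) hτ.isHermitian.eigenvalues (marginalEigenvalues hτ) 1) /
      Real.log 2 := by
  rw [qMutualInfo, vnEntropy_eq hτ.isHermitian, vnEntropy_eq hτ.ptraceR.isHermitian,
    vnEntropy_eq hτ.ptraceL.isHermitian, logInterp_marginal_zero, logInterp_marginal_one]
  ring

end ProductBasis

/-- The embedding `X ↦ X ⊗ 1` of the observables on the first two factors. -/
def tensorOne (a b c : Type*) [Fintype a] [Fintype b] [Fintype c] [DecidableEq a] [DecidableEq b]
    [DecidableEq c] : Matrix (a × b) (a × b) ℂ →⋆ₐ[ℂ] Matrix (a × b × c) (a × b × c) ℂ where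
  toFun X := (X ⊗ₖ (1 : Matrix c c ℂ)).submatrix (Equiv.prodAssoc a b c).symm
    (Equiv.prodAssoc a b c).symm
  map_one' := by rw [one_kronecker_one, submatrix_one_equiv]
  map_mul' X Y := by
    rw [submatrix_mul_equiv, ← mul_kronecker_mul, Matrix.one_mul]
  map_zero' := by rw [zero_kronecker, submatrix_zero]; rfl
  map_add' X Y := by rw [add_kronecker, submatrix_add]; rfl
  commutes' r := by
    simp only [Algebra.algebraMap_eq_smul_one]
    rw [smul_kronecker, submatrix_smul, one_kronecker_one, Pi.smul_apply, Pi.smul_apply,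
      submatrix_one_equiv]
  map_star' X := by
    rw [star_eq_conjTranspose, star_eq_conjTranspose, conjTranspose_submatrix,
      conjTranspose_kronecker, conjTranspose_one]

lemma trace_ptrace3_mul {a b c : Type*} [Fintype a] [Fintype b] [Fintype c] [DecidableEq a]
    [DecidableEq b] [DecidableEq c] (ρ : Matrix (a × b × c) (a × b × c) ℂ)
    (X : Matrix (a × b) (a × b) ℂ) :
    (ptrace3 ρ * X).trace = (ρ * tensorOne a b c X).trace := by
  set e := Equiv.prodAssoc a b c
  have h : ρ * tensorOne a b c X =
      (ρ.submatrix e e * (X ⊗ₖ (1 : Matrix c c ℂ))).submatrix e.symm e.symm := by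
    rw [← submatrix_mul_equiv _ _ _ e.symm, submatrix_submatrix]
    simp only [Equiv.self_comp_symm, submatrix_id_id]
    rfl
  rw [h]
  exact (trace_ptraceR_mul (ρ.submatrix e e) X).trans (Equiv.sum_comp e.symm _).symm

lemma ptraceR_ptrace3 {a b c : Type*} [Fintype a] [Fintype b] [Fintype c]
    (ρ : Matrix (a × b × c) (a × b × c) ℂ) : ptraceR (ptrace3 ρ) = ptraceR ρ := by
  ext i j
  simp [ptraceR, ptrace3, Fintype.sum_prod_type]

lemma ptrace3_kronecker_marginals {a b c : Type*} [Fintype a] [Fintype b] [Fintype c]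
    (ρ : Matrix (a × b × c) (a × b × c) ℂ) :
    ptrace3 (ptraceR ρ ⊗ₖ ptraceL ρ) = ptraceR (ptrace3 ρ) ⊗ₖ ptraceL (ptrace3 ρ) := by
  rw [ptraceR_ptrace3]
  ext i j
  simp only [ptrace3, ptraceL, kroneckerMap_apply, ← Finset.mul_sum]
  rw [Finset.sum_comm]

/-- monotonicity of quantum mutual information under discarding
a subsystem: S(A:BC) ≥ S(A:B). -/
theorem stmt2 {a b c : Type*} [Fintype a] [Fintype b] [Fintype c]
    [DecidableEq a] [DecidableEq b] [DecidableEq c]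
    (ρ : Matrix (a × b × c) (a × b × c) ℂ) (hρ : IsDensityMatrix ρ) :
    qMutualInfo (ptrace3 ρ) ≤ qMutualInfo ρ := by
  have h3 : (ptrace3 ρ).PosSemidef := PosSemidef.ptrace3 hρ.1
  rw [qMutualInfo_eq hρ.1, qMutualInfo_eq h3]
  refine div_le_div_of_nonneg_right ?_ (Real.log_nonneg one_le_two)
  refine relEntropy_mono (tensorOne a b c) (trace_ptrace3_mul ρ)
    (fun X => ?_) h3.isHermitian.eigenvectorUnitary_conjTranspose_mul
    (marginalBasis_conjTranspose_mul h3) hρ.1.isHermitian.eigenvectorUnitary_conjTranspose_mul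
    (marginalBasis_conjTranspose_mul hρ.1) h3.eigenvalues_nonneg (marginalEigenvalues_nonneg h3)
    hρ.1.eigenvalues_nonneg (marginalEigenvalues_nonneg hρ.1) h3.isHermitian.eq_conj_diagonal
    (kronecker_marginals_eq h3) hρ.1.isHermitian.eq_conj_diagonal (kronecker_marginals_eq hρ.1)
    (marginalOverlap_mul_eq_zero h3) (marginalOverlap_mul_eq_zero hρ.1)
  rw [← ptrace3_kronecker_marginals, trace_ptrace3_mul]
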